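/- arXiv:1602.00401 — 9 statements merged into one kernel-verified Lean document; each statement's English description precedes it below -/
import Mathlib

section
/- For every network N = (G, d, S, T), the one-shot tensor-network capacity is bounded above by the min-cut: for every tensor assignment T, the rank of the contraction matrix β_T is at most MC(N); equivalently R1(N) ≤ MC(N). -/
/-- A finite undirected multigraph without self-loops, together with disjoint
nonempty sets of source and sink vertices, in which every edge has at least
one internal endpoint (an internal vertex is one that is neither a source
nor a sink). Dimension functions on the edges are kept separate. -/
structure NetShape where
  V : Type
  E : Type
  [fintypeV : Fintype V]
  [fintypeE : Fintype E]
  [decEqV : DecidableEq V]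
  [decEqE : DecidableEq E]
  /-- the two endpoints of each edge -/
  ends : E → V × V
  no_loops : ∀ e, (ends e).1 ≠ (ends e).2
  /-- the set of source vertices -/
  S : Finset V
  /-- the set of sink vertices -/
  T : Finset V
  S_nonempty : S.Nonempty
  T_nonempty : T.Nonempty
  ST_disjoint : Disjoint S T
  /-- every edge has at least one internal endpoint -/
  edge_internal : ∀ e, ((ends e).1 ∉ S ∧ (ends e).1 ∉ T) ∨ ((ends e).2 ∉ S ∧ (ends e).2 ∉ T)

attribute [instance] NetShape.fintypeV NetShape.fintypeE NetShape.decEqV NetShape.decEqE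

namespace NetShape

variable (G : NetShape)

/-- A vertex is internal if it is neither a source nor a sink. -/
def Internal (v : G.V) : Prop := v ∉ G.S ∧ v ∉ G.T

instance : DecidablePred G.Internal := fun _ => instDecidableAnd

/-- `e` is incident to `v` if `v` is one of its endpoints. -/
def Incident (v : G.V) (e : G.E) : Prop := (G.ends e).1 = v ∨ (G.ends e).2 = v

instance (v : G.V) : DecidablePred (G.Incident v) := fun _ => instDecidableOr

/-- A source edge: one of its endpoints is a source. -/
def IsSourceEdge (e : G.E) : Prop := (G.ends e).1 ∈ G.S ∨ (G.ends e).2 ∈ G.S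

/-- A sink edge: one of its endpoints is a sink. -/
def IsSinkEdge (e : G.E) : Prop := (G.ends e).1 ∈ G.T ∨ (G.ends e).2 ∈ G.T

/-- An internal edge: both endpoints are internal, i.e. it is neither a source
edge nor a sink edge. -/
def IsInternalEdge (e : G.E) : Prop := ¬ G.IsSourceEdge e ∧ ¬ G.IsSinkEdge e

instance : DecidablePred G.IsSourceEdge := fun _ => instDecidableOr
instance : DecidablePred G.IsSinkEdge := fun _ => instDecidableOr
instance : DecidablePred G.IsInternalEdge := fun _ => instDecidableAnd

/-- A tensor assignment for the dimension function `d`: each internal vertex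
`u` carries a tensor with one index of size `d e` for each edge `e` incident
to `u`. -/
def TensorAssignment (d : G.E → ℕ) : Type :=
  ∀ u : {v : G.V // G.Internal v},
    ((e : {e : G.E // G.Incident u.1 e}) → Fin (d e.1)) → ℂ

/-- Combine index assignments on source, sink and internal edges into an index
assignment on all edges. -/
def fullIndex (d : G.E → ℕ)
    (a : (e : {e : G.E // G.IsSourceEdge e}) → Fin (d e.1))
    (b : (e : {e : G.E // G.IsSinkEdge e}) → Fin (d e.1))
    (c : (e : {e : G.E // G.IsInternalEdge e}) → Fin (d e.1))
    (e : G.E) : Fin (d e) :=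
  if h : G.IsSourceEdge e then a ⟨e, h⟩
  else if h' : G.IsSinkEdge e then b ⟨e, h'⟩
  else c ⟨e, ⟨h, h'⟩⟩

/-- The contraction of the tensor network: the matrix `β_𝒯`, with rows indexed
by the indices of the sink edges and columns by the indices of the source
edges, obtained by summing over all indices of the internal edges the product
over internal vertices of the corresponding tensor entries. -/
noncomputable def contraction (d : G.E → ℕ) (𝒯 : G.TensorAssignment d) :
    Matrix ((e : {e : G.E // G.IsSinkEdge e}) → Fin (d e.1))
           ((e : {e : G.E // G.IsSourceEdge e}) → Fin (d e.1)) ℂ :=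
  fun b a =>
    ∑ c : (e : {e : G.E // G.IsInternalEdge e}) → Fin (d e.1),
      ∏ u : {v : G.V // G.Internal v},
        𝒯 u (fun e => G.fullIndex d a b c e.1)

/-- The one-shot tensor-network capacity: the maximal rank of the contraction
over all tensor assignments. -/
noncomputable def R1 (d : G.E → ℕ) : ℕ :=
  sSup { r | ∃ 𝒯 : G.TensorAssignment d, (G.contraction d 𝒯).rank = r }

/-- A cut, given by the source side `A`: it contains all sources and no sinks
(the sink side is the complement of `A`). -/
def IsCut (A : Finset G.V) : Prop := G.S ⊆ A ∧ ∀ v ∈ G.T, v ∉ A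

/-- An edge crosses the cut with source side `A` if exactly one of its
endpoints lies in `A`. -/
def Crosses (A : Finset G.V) (e : G.E) : Prop :=
  ((G.ends e).1 ∈ A ∧ (G.ends e).2 ∉ A) ∨ ((G.ends e).1 ∉ A ∧ (G.ends e).2 ∈ A)

instance (A : Finset G.V) : DecidablePred (G.Crosses A) := fun _ => instDecidableOr

/-- The value of a cut: the product of the dimensions of the crossing edges. -/
def cutValue (d : G.E → ℕ) (A : Finset G.V) : ℕ :=
  ∏ e ∈ Finset.univ.filter (G.Crosses A), d e

/-- The min-cut: the minimum cut value over all cuts. -/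
noncomputable def MC (d : G.E → ℕ) : ℕ :=
  sInf { w | ∃ A : Finset G.V, G.IsCut A ∧ G.cutValue d A = w }

end NetShape

namespace NetShape

/-- If `L` ignores the coordinates outside `X ∪ I` and `R` ignores those in `I \ X`, then
`∑ f, L f * R f` factors through the assignments on `X`. -/
theorem sum_mul_eq_sum_pi_subtype {ι κ : Type*} {E : Type*} [Fintype E] [DecidableEq E] (d : E → ℕ)
    (hd : ∀ e, 0 < d e) (X I : E → Prop) [DecidablePred X] [DecidablePred I]
    (L : ι → ((e : E) → Fin (d e)) → ℂ) (R : κ → ((e : E) → Fin (d e)) → ℂ)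
    (hL : ∀ a f g, (∀ e, X e ∨ I e → f e = g e) → L a f = L a g)
    (hR : ∀ b f g, (∀ e, X e ∨ ¬ I e → f e = g e) → R b f = R b g) :
    ∃ (P : κ → ((e : {e // X e}) → Fin (d e)) → ℂ) (Q : ((e : {e // X e}) → Fin (d e)) → ι → ℂ),
      ∀ b a, ∑ f, R b f * L a f = ∑ x, P b x * Q x a := by
  let e₁ := Equiv.piEquivPiSubtypeProd X (fun e => Fin (d e))
  let e₂ := Equiv.piEquivPiSubtypeProd (fun e : {e // ¬ X e} => I e.1) (fun e => Fin (d e.1))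
  refine ⟨fun b x => ∑ q, R b (e₁.symm (x, e₂.symm (fun e => ⟨0, hd _⟩, q))),
    fun x a => ∑ p, L a (e₁.symm (x, e₂.symm (p, fun e => ⟨0, hd _⟩))), fun b a => ?_⟩
  rw [← e₁.symm.sum_comp, Fintype.sum_prod_type]
  refine Finset.sum_congr rfl fun x _ => ?_
  rw [← e₂.symm.sum_comp, Fintype.sum_prod_type_right, Finset.sum_mul_sum]
  refine Finset.sum_congr rfl fun q _ => Finset.sum_congr rfl fun p _ => ?_
  congr 1
  · refine hR _ _ _ fun e he => ?_
    by_cases hX : X e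
    · simp [e₁, hX]
    · simp [e₁, e₂, hX, he.resolve_left hX]
  · refine hL _ _ _ fun e he => ?_
    by_cases hX : X e
    · simp [e₁, hX]
    · simp [e₁, e₂, hX, he.resolve_left hX]

variable {G : NetShape} {d : G.E → ℕ}

theorem IsSourceEdge.not_isSinkEdge {e : G.E} (hs : G.IsSourceEdge e) : ¬ G.IsSinkEdge e := by
  have := G.edge_internal e
  have h₁ : (G.ends e).1 ∈ G.S → (G.ends e).1 ∉ G.T :=
    fun h => Finset.disjoint_left.1 G.ST_disjoint h
  have h₂ : (G.ends e).2 ∈ G.S → (G.ends e).2 ∉ G.T :=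
    fun h => Finset.disjoint_left.1 G.ST_disjoint h
  unfold IsSourceEdge at hs
  unfold IsSinkEdge
  tauto

theorem sum_fullIndex (H : ((e : G.E) → Fin (d e)) → ℂ)
    (a : (e : {e : G.E // G.IsSourceEdge e}) → Fin (d e.1))
    (b : (e : {e : G.E // G.IsSinkEdge e}) → Fin (d e.1)) :
    ∑ c, H (G.fullIndex d a b c) =
      ∑ f with (∀ e : {e : G.E // G.IsSinkEdge e}, f e.1 = b e) ∧
        ∀ e : {e : G.E // G.IsSourceEdge e}, f e.1 = a e, H f := by
  refine Finset.sum_nbij' (fun c => G.fullIndex d a b c) (fun f e => f e.1) ?_ ?_ ?_ ?_ ?_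
  · intro c _
    simp only [Finset.mem_filter, Finset.mem_univ, true_and]
    refine ⟨fun e => ?_, fun e => ?_⟩
    · have h : ¬ G.IsSourceEdge e.1 := fun h => h.not_isSinkEdge e.2
      simp [fullIndex, h, e.2]
    · simp [fullIndex, e.2]
  · simp
  · intro c _
    funext e
    simp [fullIndex, e.2.1, e.2.2]
  · intro f hf
    simp only [Finset.mem_filter, Finset.mem_univ, true_and] at hf
    funext e
    unfold fullIndex
    split_ifs with h h'
    · exact (hf.2 ⟨e, h⟩).symm
    · exact (hf.1 ⟨e, h'⟩).symm
    · rfl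
  · simp

theorem rank_contraction_le_cutValue (hd : ∀ e, 0 < d e) (𝒯 : G.TensorAssignment d)
    {A : Finset G.V} (hA : G.IsCut A) : (G.contraction d 𝒯).rank ≤ G.cutValue d A := by
  refine (sum_mul_eq_sum_pi_subtype d hd (G.Crosses A) (fun e => (G.ends e).1 ∈ A)
    (fun (a : (e : {e : G.E // G.IsSourceEdge e}) → Fin (d e.1)) f =>
      (if ∀ e, f e.1 = a e then 1 else 0) *
        ∏ u : {v : G.V // G.Internal v} with u.1 ∈ A, 𝒯 u (fun e => f e.1))
    (fun (b : (e : {e : G.E // G.IsSinkEdge e}) → Fin (d e.1)) f =>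
      (if ∀ e, f e.1 = b e then 1 else 0) *
        ∏ u : {v : G.V // G.Internal v} with u.1 ∉ A, 𝒯 u (fun e => f e.1)) ?_ ?_).elim fun P ⟨Q, hPQ⟩ => ?_
  · intro a f g h
    have hs : ∀ e : {e : G.E // G.IsSourceEdge e}, f e.1 = g e.1 := fun e => h _ <| by
      have h₁ := @hA.1 (G.ends e.1).1
      have h₂ := @hA.1 (G.ends e.1).2
      have := e.2
      unfold IsSourceEdge at this
      unfold Crosses
      tauto
    simp only [hs]
    congr 1
    refine Finset.prod_congr rfl fun u hu => congrArg (𝒯 u) (funext fun e => h _ ?_)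
    have hu := (Finset.mem_filter.1 hu).2
    unfold Crosses
    rcases e.2 with he | he <;> rw [← he] at hu <;> tauto
  · intro b f g h
    have hs : ∀ e : {e : G.E // G.IsSinkEdge e}, f e.1 = g e.1 := fun e => h _ <| by
      have h₁ := hA.2 (G.ends e.1).1
      have h₂ := hA.2 (G.ends e.1).2
      have := e.2
      unfold IsSinkEdge at this
      unfold Crosses
      tauto
    simp only [hs]
    congr 1
    refine Finset.prod_congr rfl fun u hu => congrArg (𝒯 u) (funext fun e => h _ ?_)
    have hu := (Finset.mem_filter.1 hu).2
    unfold Crosses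
    rcases e.2 with he | he <;> rw [← he] at hu <;> tauto
  · have hfac : G.contraction d 𝒯 = Matrix.of P * Matrix.of Q := by
      ext b a
      rw [Matrix.mul_apply]
      simp only [Matrix.of_apply]
      rw [← hPQ, contraction, sum_fullIndex (fun f => ∏ u, 𝒯 u (fun e => f e.1)),
        Finset.sum_filter]
      refine Finset.sum_congr rfl fun f _ => ?_
      rw [mul_mul_mul_comm, mul_comm (Finset.prod _ _), Finset.prod_filter_mul_prod_filter_not]
      simp only [ite_and, mul_ite, ite_mul, one_mul, mul_one, zero_mul, mul_zero]
      split_ifs <;> rfl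
    rw [hfac]
    refine (Matrix.rank_mul_le_left _ _).trans ((Matrix.rank_le_card_width _).trans ?_)
    rw [Fintype.card_pi, cutValue]
    simp only [Fintype.card_fin]
    rw [Finset.prod_subtype (Finset.univ.filter (G.Crosses A)) (p := G.Crosses A) (by simp)]

theorem rank_contraction_le_MC (hd : ∀ e, 0 < d e) (𝒯 : G.TensorAssignment d) :
    (G.contraction d 𝒯).rank ≤ G.MC d := by
  obtain ⟨A, hA, h⟩ := Nat.sInf_mem (s := {w | ∃ A : Finset G.V, G.IsCut A ∧ G.cutValue d A = w})
    ⟨_, G.S, ⟨subset_rfl, fun _ hv => Finset.disjoint_right.1 G.ST_disjoint hv⟩, rfl⟩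
  exact (rank_contraction_le_cutValue hd 𝒯 hA).trans_eq h

end NetShape

/-- For every network `N = (G, d, S, T)`, the rank of the
contraction of every tensor assignment is at most the min-cut; equivalently,
the one-shot tensor-network capacity satisfies `R1(N) ≤ MC(N)`. -/
theorem stmt0 (G : NetShape) (d : G.E → ℕ) (hd : ∀ e, 2 ≤ d e) :
    (∀ 𝒯 : G.TensorAssignment d, (G.contraction d 𝒯).rank ≤ G.MC d) ∧
    G.R1 d ≤ G.MC d := by
  have h := NetShape.rank_contraction_le_MC (G := G) (d := d) fun e => two_pos.trans_le (hd e)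
  refine ⟨h, csSup_le ⟨_, fun _ _ => 0, rfl⟩ ?_⟩
  rintro _ ⟨𝒯, rfl⟩
  exact h 𝒯
end

section
/- The one-shot tensor-network capacity is supermultiplicative under pointwise products of dimension functions: if d and d' are two dimension functions on the same graph G with the same sources S and sinks T, then R1((G, d·d', S, T)) ≥ R1((G, d, S, T)) · R1((G, d', S, T)), where (d·d')(e) = d(e)·d'(e). -/
open scoped Kronecker in
/-- The rank of matrices over a field is multiplicative under Kronecker products. -/
theorem Matrix.rank_kronecker_of_field {K m n m' n' : Type*} [Field K]
    [Fintype m] [Fintype n] [Fintype m'] [Fintype n']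
    (A : Matrix m n K) (B : Matrix m' n' K) :
    (A ⊗ₖ B).rank = A.rank * B.rank := by
  classical
  rw [Matrix.rank_eq_finrank_range_toLin (A ⊗ₖ B)
      ((Pi.basisFun K m).tensorProduct (Pi.basisFun K m'))
      ((Pi.basisFun K n).tensorProduct (Pi.basisFun K n')),
    Matrix.rank_eq_finrank_range_toLin A (Pi.basisFun K m) (Pi.basisFun K n),
    Matrix.rank_eq_finrank_range_toLin B (Pi.basisFun K m') (Pi.basisFun K n'),
    Matrix.toLin_kronecker, TensorProduct.range_map, ← TensorProduct.range_mapIncl,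
    ← Module.finrank_tensorProduct]
  exact LinearMap.finrank_range_of_inj
    (TensorProduct.map_injective_of_flat_flat _ _
      (Submodule.subtype_injective _) (Submodule.subtype_injective _))

namespace NetShape

/-- Splitting a family of indices of product dimensions into a pair of families. -/
def splitIndex {ι : Type*} (P : ι → Prop) (p q : ι → ℕ) :
    ((i : {i // P i}) → Fin (p i.1 * q i.1)) ≃
      ((i : {i // P i}) → Fin (p i.1)) × ((i : {i // P i}) → Fin (q i.1)) where
  toFun x := (fun i => (finProdFinEquiv.symm (x i)).1, fun i => (finProdFinEquiv.symm (x i)).2)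
  invFun y := fun i => finProdFinEquiv (y.1 i, y.2 i)
  left_inv x := by ext i; simp only [Prod.mk.eta, Equiv.apply_symm_apply]
  right_inv y := by ext i <;> simp only [Equiv.symm_apply_apply]

variable (G : NetShape) {d d' : G.E → ℕ}

/-- The vertexwise tensor product of two tensor assignments. -/
noncomputable def TensorAssignment.prod (𝒯 : G.TensorAssignment d) (𝒯' : G.TensorAssignment d') :
    G.TensorAssignment (fun e => d e * d' e) := fun u x =>
  𝒯 u (splitIndex (G.Incident u.1) d d' x).1 *
    𝒯' u (splitIndex (G.Incident u.1) d d' x).2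

open scoped Kronecker in
theorem contraction_prod (𝒯 : G.TensorAssignment d) (𝒯' : G.TensorAssignment d') :
    G.contraction (fun e => d e * d' e) (TensorAssignment.prod G 𝒯 𝒯') =
      (G.contraction d 𝒯 ⊗ₖ G.contraction d' 𝒯').submatrix
        (splitIndex G.IsSinkEdge d d') (splitIndex G.IsSourceEdge d d') := by
  ext b a
  simp only [Matrix.submatrix_apply, Matrix.kroneckerMap_apply, contraction]
  rw [Finset.sum_mul_sum, ← Fintype.sum_prod_type']
  refine Fintype.sum_equiv (splitIndex G.IsInternalEdge d d') _ _ fun c => ?_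
  rw [← Finset.prod_mul_distrib]
  refine Finset.prod_congr rfl fun u _ => ?_
  unfold TensorAssignment.prod
  congr 2 <;>
  · funext e
    simp only [splitIndex, Equiv.coe_fn_mk, fullIndex]
    split_ifs <;> rfl

theorem rank_contraction_le_R1 (𝒯 : G.TensorAssignment d) :
    (G.contraction d 𝒯).rank ≤ G.R1 d := by
  refine le_csSup ⟨Fintype.card ((e : {e : G.E // G.IsSourceEdge e}) → Fin (d e.1)), ?_⟩ ⟨𝒯, rfl⟩
  rintro _ ⟨𝒯', rfl⟩
  exact Matrix.rank_le_card_width _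

variable (d) in
theorem exists_rank_contraction_eq_R1 :
    ∃ 𝒯 : G.TensorAssignment d, (G.contraction d 𝒯).rank = G.R1 d := by
  refine Nat.sSup_mem (s := {r | ∃ 𝒯 : G.TensorAssignment d, (G.contraction d 𝒯).rank = r})
    ⟨_, fun _ _ => 0, rfl⟩ ⟨Fintype.card ((e : {e : G.E // G.IsSourceEdge e}) → Fin (d e.1)), ?_⟩
  rintro _ ⟨𝒯', rfl⟩
  exact Matrix.rank_le_card_width _

end NetShape

/-- supermultiplicativity of the one-shot tensor-network
capacity under pointwise products of dimension functions:
`R1((G, d·d', S, T)) ≥ R1((G, d, S, T)) · R1((G, d', S, T))`. -/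
theorem stmt4 (G : NetShape) (d d' : G.E → ℕ)
    (hd : ∀ e, 2 ≤ d e) (hd' : ∀ e, 2 ≤ d' e) :
    G.R1 d * G.R1 d' ≤ G.R1 (fun e => d e * d' e) := by
  obtain ⟨𝒯, h⟩ := G.exists_rank_contraction_eq_R1 d
  obtain ⟨𝒯', h'⟩ := G.exists_rank_contraction_eq_R1 d'
  rw [← h, ← h', ← Matrix.rank_kronecker_of_field,
    ← Matrix.rank_submatrix _ (NetShape.splitIndex G.IsSinkEdge d d')
      (NetShape.splitIndex G.IsSourceEdge d d'),
    ← NetShape.contraction_prod]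
  exact G.rank_contraction_le_R1 _
end

section
/- For the butterfly-type network B(5,3,3,5,2) the one-shot tensor-network capacity is strictly below the min-cut: every tensor assignment T1 : Fin 5 × Fin 3 × Fin 2 → ℂ, T2 : Fin 3 × Fin 5 × Fin 2 → ℂ gives rank M(T1,T2) ≤ 14, there exists a tensor assignment with rank M(T1,T2) = 14, and MC(B(5,3,3,5,2)) = 15; hence R1(B(5,3,3,5,2)) = 14 < 15 = MC(B(5,3,3,5,2)). -/
/-- The contraction matrix of the butterfly-type network `B(d1,d2,d3,d4,d5)`
for a tensor assignment `(T1, T2)`: rows are indexed by the sink-edge indices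
`Fin d3 × Fin d4`, columns by the source-edge indices `Fin d1 × Fin d2`, and
the entry at `((a3,a4),(a1,a2))` is `∑ j, T1 (a1,a3,j) * T2 (a2,a4,j)`. -/
noncomputable def butterflyM (d1 d2 d3 d4 d5 : ℕ)
    (T1 : Fin d1 × Fin d3 × Fin d5 → ℂ) (T2 : Fin d2 × Fin d4 × Fin d5 → ℂ) :
    Matrix (Fin d3 × Fin d4) (Fin d1 × Fin d2) ℂ :=
  fun r c => ∑ j : Fin d5, T1 (c.1, r.1, j) * T2 (c.2, r.2, j)

/-- The one-shot tensor-network capacity of the butterfly-type network: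
the maximal rank of the contraction matrix over all tensor assignments. -/
noncomputable def butterflyR1 (d1 d2 d3 d4 d5 : ℕ) : ℕ :=
  sSup { n | ∃ (T1 : Fin d1 × Fin d3 × Fin d5 → ℂ)
               (T2 : Fin d2 × Fin d4 × Fin d5 → ℂ),
               (butterflyM d1 d2 d3 d4 d5 T1 T2).rank = n }

/-- The min-cut of the butterfly-type network `B(d1,d2,d3,d4,d5)`:
`min (d1·d2, d3·d4, d2·d3·d5, d1·d4·d5)`. -/
def butterflyMC (d1 d2 d3 d4 d5 : ℕ) : ℕ :=
  min (min (d1 * d2) (d3 * d4)) (min (d2 * d3 * d5) (d1 * d4 * d5))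

open Module in
/-- A pair of linear maps from a 3-dimensional to a 5-dimensional space has a common
2-dimensional subspace whose images together span at most 3 dimensions. -/
theorem exists_finrank_eq_two_and_map_sup_le {K F E : Type*} [Field K]
    [AddCommGroup F] [Module K F] [AddCommGroup E] [Module K E]
    [FiniteDimensional K F] [FiniteDimensional K E]
    (hF : finrank K F = 3) (hE : finrank K E = 5) (C D : F →ₗ[K] E) :
    ∃ V : Submodule K F, finrank K V = 2 ∧ finrank K (V.map C ⊔ V.map D : Submodule K E) ≤ 3 := by
  have hker : LinearMap.ker (C.coprod D) ≠ ⊥ :=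
    LinearMap.ker_ne_bot_of_finrank_lt (by simp [hF, hE])
  obtain ⟨⟨v, w⟩, hvw, hne⟩ := Submodule.exists_mem_ne_zero_of_ne_bot hker
  have hdual : LinearMap.ker ((Dual.eval K F v).prod (Dual.eval K F w)) ≠ ⊥ :=
    LinearMap.ker_ne_bot_of_finrank_lt (by simp [Subspace.dual_finrank_eq, hF])
  obtain ⟨f, hf, hf0⟩ := Submodule.exists_mem_ne_zero_of_ne_bot hdual
  have hfv : f v = 0 ∧ f w = 0 := by simpa using hf
  have hV : finrank K (LinearMap.ker f) = 2 := by
    have := Dual.finrank_ker_add_one_of_ne_zero hf0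
    omega
  refine ⟨LinearMap.ker f, hV, ?_⟩
  set V := LinearMap.ker f
  rw [← LinearMap.range_domRestrict, ← LinearMap.range_domRestrict, ← LinearMap.range_coprod]
  set g := (C.domRestrict V).coprod (D.domRestrict V)
  have hrk := LinearMap.finrank_range_add_finrank_ker g
  have hpos : 0 < finrank K (LinearMap.ker g) := by
    rw [Nat.pos_iff_ne_zero, Ne, Submodule.finrank_eq_zero, ← Ne, Submodule.ne_bot_iff]
    refine ⟨(⟨v, hfv.1⟩, ⟨w, hfv.2⟩), hvw, fun h => hne ?_⟩
    rw [Prod.mk_eq_zero] at h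
    exact Prod.ext (congrArg Subtype.val h.1) (congrArg Subtype.val h.2)
  rw [finrank_prod, hV] at hrk
  omega

open Module in
/-- If two linear maps `A, B` send `U` into `L`, and two linear maps `C, D` send `V` into `W`, with
`dim L * dim W < dim U * dim V`, then `A ⊗ C + B ⊗ D` is not injective. -/
theorem not_injective_map_add_map {K E F E' F' : Type*} [Field K]
    [AddCommGroup E] [Module K E] [AddCommGroup F] [Module K F]
    [AddCommGroup E'] [Module K E'] [AddCommGroup F'] [Module K F']
    [FiniteDimensional K E] [FiniteDimensional K F]
    [FiniteDimensional K E'] [FiniteDimensional K F']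
    (A B : E →ₗ[K] E') (C D : F →ₗ[K] F')
    (U : Submodule K E) (L : Submodule K E') (V : Submodule K F) (W : Submodule K F')
    (hA : ∀ x ∈ U, A x ∈ L) (hB : ∀ x ∈ U, B x ∈ L)
    (hC : ∀ x ∈ V, C x ∈ W) (hD : ∀ x ∈ V, D x ∈ W)
    (hlt : finrank K L * finrank K W < finrank K U * finrank K V) :
    ¬ Function.Injective (TensorProduct.map A C + TensorProduct.map B D) := by
  intro hinj
  have hcomm : TensorProduct.map L.subtype W.subtype ∘ₗ
        (TensorProduct.map (A.restrict hA) (C.restrict hC) +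
          TensorProduct.map (B.restrict hB) (D.restrict hD)) =
      (TensorProduct.map A C + TensorProduct.map B D) ∘ₗ
        TensorProduct.map U.subtype V.subtype := by
    ext x y
    simp
  have hsub : Function.Injective (TensorProduct.map U.subtype V.subtype) :=
    TensorProduct.map_injective_of_flat_flat _ _ U.subtype_injective V.subtype_injective
  have hcomp : Function.Injective (TensorProduct.map L.subtype W.subtype ∘ₗ
      (TensorProduct.map (A.restrict hA) (C.restrict hC) +
        TensorProduct.map (B.restrict hB) (D.restrict hD))) := by
    rw [hcomm]
    exact hinj.comp hsub
  have hle := LinearMap.finrank_le_finrank_of_injective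
    (Function.Injective.of_comp (f := TensorProduct.map L.subtype W.subtype) hcomp)
  rw [finrank_tensorProduct, finrank_tensorProduct] at hle
  omega

open Module in
/-- For `A, B` from dimension 5 to dimension 3 and `C, D` from dimension 3 to dimension 5,
the map `A ⊗ C + B ⊗ D` is never injective. -/
theorem not_injective_map_add_map_of_finrank_five_three {K E F E' F' : Type*} [Field K]
    [AddCommGroup E] [Module K E] [AddCommGroup F] [Module K F]
    [AddCommGroup E'] [Module K E'] [AddCommGroup F'] [Module K F']
    [FiniteDimensional K E] [FiniteDimensional K F]
    [FiniteDimensional K E'] [FiniteDimensional K F']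
    (hE : finrank K E = 5) (hE' : finrank K E' = 3) (hF : finrank K F = 3) (hF' : finrank K F' = 5)
    (A B : E →ₗ[K] E') (C D : F →ₗ[K] F') :
    ¬ Function.Injective (TensorProduct.map A C + TensorProduct.map B D) := by
  obtain ⟨V, hV, hW⟩ := exists_finrank_eq_two_and_map_sup_le hF hF' C D
  obtain ⟨P, hP, hQ⟩ := exists_finrank_eq_two_and_map_sup_le
    (by rw [Subspace.dual_finrank_eq, hE']) (by rw [Subspace.dual_finrank_eq, hE])
    A.dualMap B.dualMap
  set W := V.map C ⊔ V.map D
  set Q := P.map A.dualMap ⊔ P.map B.dualMap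
  have hU := Subspace.finrank_add_finrank_dualCoannihilator_eq Q
  have hL := Subspace.finrank_add_finrank_dualCoannihilator_eq P
  refine not_injective_map_add_map A B C D Q.dualCoannihilator P.dualCoannihilator V W
    (fun x hx => ?_) (fun x hx => ?_)
    (fun x hx => Submodule.mem_sup_left (Submodule.mem_map_of_mem hx))
    (fun x hx => Submodule.mem_sup_right (Submodule.mem_map_of_mem hx)) ?_
  · rw [Submodule.mem_dualCoannihilator] at hx ⊢
    exact fun φ hφ => hx _ (Submodule.mem_sup_left (Submodule.mem_map_of_mem hφ))
  · rw [Submodule.mem_dualCoannihilator] at hx ⊢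
    exact fun φ hφ => hx _ (Submodule.mem_sup_right (Submodule.mem_map_of_mem hφ))
  · have hL1 : finrank K P.dualCoannihilator = 1 := by omega
    rw [hL1, hV]
    omega

open scoped Kronecker in
theorem butterflyM_eq_kronecker_add_kronecker {d1 d2 d3 d4 : ℕ}
    (T1 : Fin d1 × Fin d3 × Fin 2 → ℂ) (T2 : Fin d2 × Fin d4 × Fin 2 → ℂ) :
    butterflyM d1 d2 d3 d4 2 T1 T2 =
      (Matrix.of fun i j => T1 (j, i, 0)) ⊗ₖ (Matrix.of fun i j => T2 (j, i, 0)) +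
        (Matrix.of fun i j => T1 (j, i, 1)) ⊗ₖ (Matrix.of fun i j => T2 (j, i, 1)) := by
  ext r c
  simp [butterflyM]

theorem rank_butterflyM_le_fourteen
    (T1 : Fin 5 × Fin 3 × Fin 2 → ℂ) (T2 : Fin 3 × Fin 5 × Fin 2 → ℂ) :
    (butterflyM 5 3 3 5 2 T1 T2).rank ≤ 14 := by
  have hM := butterflyM_eq_kronecker_add_kronecker T1 T2
  have hni := not_injective_map_add_map_of_finrank_five_three (K := ℂ)
    (by simp) (by simp) (by simp) (by simp)
    (Matrix.toLin (Pi.basisFun ℂ (Fin 5)) (Pi.basisFun ℂ (Fin 3)) (.of fun i j => T1 (j, i, 0)))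
    (Matrix.toLin (Pi.basisFun ℂ (Fin 5)) (Pi.basisFun ℂ (Fin 3)) (.of fun i j => T1 (j, i, 1)))
    (Matrix.toLin (Pi.basisFun ℂ (Fin 3)) (Pi.basisFun ℂ (Fin 5)) (.of fun i j => T2 (j, i, 0)))
    (Matrix.toLin (Pi.basisFun ℂ (Fin 3)) (Pi.basisFun ℂ (Fin 5)) (.of fun i j => T2 (j, i, 1)))
  rw [← Matrix.toLin_kronecker, ← Matrix.toLin_kronecker, ← map_add, ← hM,
    ← LinearMap.ker_eq_bot, ← Submodule.finrank_eq_zero (R := ℂ)] at hni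
  have hrk := LinearMap.finrank_range_add_finrank_ker
    (Matrix.toLin ((Pi.basisFun ℂ (Fin 5)).tensorProduct (Pi.basisFun ℂ (Fin 3)))
      ((Pi.basisFun ℂ (Fin 3)).tensorProduct (Pi.basisFun ℂ (Fin 5)))
      (butterflyM 5 3 3 5 2 T1 T2))
  rw [← Matrix.rank_eq_finrank_range_toLin, Module.finrank_tensorProduct] at hrk
  simp only [Module.finrank_fin_fun] at hrk
  omega

/-- The tensor of the `3 × 5` pencil that is the direct sum of the Kronecker blocks `L₁` and `L₂`,
as a function of the column, the row and the pencil variable. -/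
def kroneckerBlocks : Fin 5 × Fin 3 × Fin 2 → ℂ := fun p =>
  (![!![1, 0, 0, 0, 0; 0, 0, 1, 0, 0; 0, 0, 0, 1, 0],
    !![0, 1, 0, 0, 0; 0, 0, 0, 1, 0; 0, 0, 0, 0, 1]] p.2.2 : Matrix (Fin 3) (Fin 5) ℂ) p.2.1 p.1

theorem eq_zero_of_butterflyM_kroneckerBlocks_mulVec {x : Fin 5 × Fin 3 → ℂ}
    (hx : (butterflyM 5 3 3 5 2 kroneckerBlocks
      fun p => kroneckerBlocks (p.2.1, p.1, p.2.2)).mulVec x = 0) (h0 : x (0, 2) = 0) :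
    x = 0 := by
  have h (i : Fin 3) (j : Fin 5) := congrFun hx (i, j)
  simp only [Fin.forall_fin_succ, Matrix.mulVec, dotProduct, butterflyM, kroneckerBlocks,
    Fintype.sum_prod_type, Fin.sum_univ_succ] at h
  simp at h
  ext ⟨i, j⟩
  fin_cases i <;> fin_cases j <;> simp <;> grind

theorem rank_butterflyM_kroneckerBlocks :
    14 ≤ (butterflyM 5 3 3 5 2 kroneckerBlocks
      fun p => kroneckerBlocks (p.2.1, p.1, p.2.2)).rank := by
  set M := butterflyM 5 3 3 5 2 kroneckerBlocks fun p => kroneckerBlocks (p.2.1, p.1, p.2.2)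
  have hrk := LinearMap.finrank_range_add_finrank_ker M.mulVecLin
  have hker : Module.finrank ℂ (LinearMap.ker M.mulVecLin) ≤ 1 := by
    rw [← Module.finrank_self ℂ]
    refine LinearMap.finrank_le_finrank_of_injective
      (f := (LinearMap.proj (0, 2)).domRestrict (LinearMap.ker M.mulVecLin)) ?_
    rw [injective_iff_map_eq_zero]
    intro x hx
    exact Subtype.ext (eq_zero_of_butterflyM_kroneckerBlocks_mulVec x.2 hx)
  rw [Module.finrank_fintype_fun_eq_card] at hrk
  simp only [Fintype.card_prod, Fintype.card_fin] at hrk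
  rw [Matrix.rank]
  omega

/-- for `B(5,3,3,5,2)` the one-shot tensor-network capacity is
strictly below the min-cut: every tensor assignment has rank at most `14`,
some tensor assignment achieves rank `14`, so `R1 = 14 < 15 = MC`. -/
theorem stmt8 :
    (∀ (T1 : Fin 5 × Fin 3 × Fin 2 → ℂ) (T2 : Fin 3 × Fin 5 × Fin 2 → ℂ),
      (butterflyM 5 3 3 5 2 T1 T2).rank ≤ 14) ∧
    (∃ (T1 : Fin 5 × Fin 3 × Fin 2 → ℂ) (T2 : Fin 3 × Fin 5 × Fin 2 → ℂ),
      (butterflyM 5 3 3 5 2 T1 T2).rank = 14) ∧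
    butterflyR1 5 3 3 5 2 = 14 ∧
    butterflyMC 5 3 3 5 2 = 15 := by
  have hex : ∃ (T1 : Fin 5 × Fin 3 × Fin 2 → ℂ) (T2 : Fin 3 × Fin 5 × Fin 2 → ℂ),
      (butterflyM 5 3 3 5 2 T1 T2).rank = 14 :=
    ⟨_, _, (rank_butterflyM_le_fourteen _ _).antisymm rank_butterflyM_kroneckerBlocks⟩
  refine ⟨rank_butterflyM_le_fourteen, hex, ?_, rfl⟩
  refine IsGreatest.csSup_eq ⟨hex, ?_⟩
  rintro n ⟨T1, T2, rfl⟩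
  exact rank_butterflyM_le_fourteen T1 T2
end

section
/- For every integer d5 ≥ 2, the butterfly-type network B(2,3,3,2,d5) has one-shot tensor-network capacity R1 equal to 6: there exist tensors T1 : Fin 2 × Fin 3 × Fin d5 → ℂ and T2 : Fin 3 × Fin 2 × Fin d5 → ℂ whose 6×6 contraction matrix M(T1,T2) has rank 6 (is invertible), and no tensor assignment gives rank exceeding 6. -/
theorem butterflyM_rank_le (d1 d2 d3 d4 d5 : ℕ)
    (T1 : Fin d1 × Fin d3 × Fin d5 → ℂ) (T2 : Fin d2 × Fin d4 × Fin d5 → ℂ) :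
    (butterflyM d1 d2 d3 d4 d5 T1 T2).rank ≤ d1 * d2 := by
  simpa using (butterflyM d1 d2 d3 d4 d5 T1 T2).rank_le_card_width

/-- The tensors `T1 (a1, a3, j) = [a3 = a1 + j]` and `T2 (a2, a4, j) = [a2 = a4 + j]`, supported on
`j < 2`, give an invertible contraction matrix. -/
theorem exists_butterflyM_rank_eq_six (d5 : ℕ) (h5 : 2 ≤ d5) :
    ∃ (T1 : Fin 2 × Fin 3 × Fin d5 → ℂ) (T2 : Fin 3 × Fin 2 × Fin d5 → ℂ),
      (butterflyM 2 3 3 2 d5 T1 T2).rank = 6 := by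
  obtain ⟨m, rfl⟩ := Nat.exists_eq_add_of_le' h5
  let T1 : Fin 2 × Fin 3 × Fin (m + 2) → ℂ := fun x =>
    if x.2.2.val < 2 ∧ x.2.1.val = x.1.val + x.2.2.val then 1 else 0
  let T2 : Fin 3 × Fin 2 × Fin (m + 2) → ℂ := fun x =>
    if x.2.2.val < 2 ∧ x.1.val = x.2.1.val + x.2.2.val then 1 else 0
  refine ⟨T1, T2, ?_⟩
  have entry (r : Fin 3 × Fin 2) (c : Fin 2 × Fin 3) :
      butterflyM 2 3 3 2 (m + 2) T1 T2 r c =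
        (if r.1.val = c.1.val ∧ c.2.val = r.2.val then 1 else 0) +
        (if r.1.val = c.1.val + 1 ∧ c.2.val = r.2.val + 1 then 1 else 0) := by
    simp only [and_comm (a := r.1.val = _)]
    simp [butterflyM, T1, T2, Fin.sum_univ_succ, ite_and]
  have inj : Function.Injective (butterflyM 2 3 3 2 (m + 2) T1 T2).mulVecLin := by
    rw [← LinearMap.ker_eq_bot, LinearMap.ker_eq_bot']
    intro v hv
    have h (r : Fin 3 × Fin 2) := congrFun hv r
    simp only [Matrix.mulVecLin_apply, Matrix.mulVec, dotProduct, entry, Fintype.sum_prod_type,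
      Pi.zero_apply] at h
    have h00 := h (0, 0)
    have h01 := h (0, 1)
    have h10 := h (1, 0)
    have h11 := h (1, 1)
    have h20 := h (2, 0)
    have h21 := h (2, 1)
    simp [Fin.sum_univ_succ] at h00 h01 h10 h11 h20 h21
    ext ⟨i, k⟩
    fin_cases i <;> fin_cases k <;> simp_all
  rw [Matrix.rank, LinearMap.finrank_range_of_inj inj]
  simp

/-- for every `d5 ≥ 2`, the butterfly-type network `B(2,3,3,2,d5)`
has one-shot tensor-network capacity `6`: some tensor assignment gives a
contraction matrix of full rank `6`, and no tensor assignment exceeds rank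
`6`. -/
theorem stmt9 (d5 : ℕ) (h5 : 2 ≤ d5) :
    (∃ (T1 : Fin 2 × Fin 3 × Fin d5 → ℂ) (T2 : Fin 3 × Fin 2 × Fin d5 → ℂ),
      (butterflyM 2 3 3 2 d5 T1 T2).rank = 6) ∧
    (∀ (T1 : Fin 2 × Fin 3 × Fin d5 → ℂ) (T2 : Fin 3 × Fin 2 × Fin d5 → ℂ),
      (butterflyM 2 3 3 2 d5 T1 T2).rank ≤ 6) ∧
    butterflyR1 2 3 3 2 d5 = 6 := by
  have hmax := exists_butterflyM_rank_eq_six d5 h5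
  refine ⟨hmax, butterflyM_rank_le 2 3 3 2 d5, IsGreatest.csSup_eq ⟨hmax, ?_⟩⟩
  rintro n ⟨T1, T2, rfl⟩
  exact butterflyM_rank_le 2 3 3 2 d5 T1 T2
end

section
/- There exists a two-round classical network code on the cyclic orientation of the butterfly-type network with middle edge of dimension 4 (split as 2×2) that perfectly transmits all 6 source messages: there exist functions g : Fin 3 → Fin 2 (message from n2 to n1), h : Fin 2 × Fin 2 → Fin 2 (message from n1 back to n2, depending on the n1-input and the received g-value), f1 : Fin 2 × Fin 2 → Fin 3 (message from n1 to the sink), f2 : Fin 3 × Fin 2 → Fin 2 (message from n2 to the sink), and a decoder D : Fin 3 × Fin 2 → Fin 2 × Fin 3, such that for all x1 : Fin 2 and x2 : Fin 3, D(f1(x1, g(x2)), f2(x2, h(x1, g(x2)))) = (x1, x2). Consequently the one-shot classical capacity of this cyclic directed network with d1 = d4 = 2, d2 = d3 = 3, d5 = 4 equals the min-cut value 6. -/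
/-- there is a two-round classical network code on the cyclic
orientation of the butterfly-type network with `d1 = d4 = 2`, `d2 = d3 = 3`
and middle edge of dimension `4` split as `2 × 2` (one channel `n2 → n1` of
size `2` carrying `g x2`, one channel `n1 → n2` of size `2` carrying
`h (x1, g x2)`) that perfectly transmits all `6` source messages
`(x1, x2) : Fin 2 × Fin 3`; hence the one-shot classical capacity of this
cyclic directed network equals the min-cut value `6`. -/
theorem stmt10 :
    ∃ (g : Fin 3 → Fin 2) (h : Fin 2 × Fin 2 → Fin 2)
      (f1 : Fin 2 × Fin 2 → Fin 3) (f2 : Fin 3 × Fin 2 → Fin 2)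
      (D : Fin 3 × Fin 2 → Fin 2 × Fin 3),
      ∀ (x1 : Fin 2) (x2 : Fin 3),
        D (f1 (x1, g x2), f2 (x2, h (x1, g x2))) = (x1, x2) := by
  refine ⟨![0, 0, 1], Prod.fst, fun p => if p.2 = 0 then p.1.castSucc else 2,
    fun p => ![0, 1, p.2] p.1, fun p => ![(0, p.2.castSucc), (1, p.2.castSucc), (p.2, 2)] p.1, ?_⟩
  decide
end

section
/- There exists a classical network code on the acyclic orientation of the butterfly-type network with d1 = d4 = 2, d2 = d3 = 3 and middle channel directed from n2 to n1 of alphabet size 2 that perfectly transmits 5 messages: there exist an injective encoder enc : Fin 5 → Fin 2 × Fin 3 and functions g : Fin 3 → Fin 2 (message from n2 to n1), f1 : Fin 2 × Fin 2 → Fin 3 (message from n1 to the sink, depending on the n1-input and the received g-value), f2 : Fin 3 → Fin 2 (message from n2 to the sink), and a decoder D : Fin 3 × Fin 2 → Fin 5, such that for every m : Fin 5, writing (x1, x2) = enc(m), D(f1(x1, g(x2)), f2(x2)) = m. Hence the one-shot classical capacity of this directed network is at least 5. -/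
/-- there is a classical network code on the acyclic orientation
of the butterfly-type network with `d1 = d4 = 2`, `d2 = d3 = 3` and middle
channel `n2 → n1` of alphabet size `2` that perfectly transmits `5` messages:
an injective encoder `enc : Fin 5 → Fin 2 × Fin 3` of the source messages into
the channel inputs `(x1, x2)`, together with node functions `g, f1, f2` and a
decoder `D` recovering every message; hence the one-shot classical capacity of
this directed network is at least `5`. -/
theorem stmt11 :
    ∃ (enc : Fin 5 → Fin 2 × Fin 3) (g : Fin 3 → Fin 2)
      (f1 : Fin 2 × Fin 2 → Fin 3) (f2 : Fin 3 → Fin 2)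
      (D : Fin 3 × Fin 2 → Fin 5),
      Function.Injective enc ∧
      ∀ m : Fin 5,
        D (f1 ((enc m).1, g (enc m).2), f2 (enc m).2) = m := by
  refine ⟨![(0, 0), (1, 0), (0, 1), (0, 2), (1, 2)], ![0, 1, 0],
    fun p => !![0, 2; 1, 2] p.1 p.2, ![0, 0, 1],
    fun p => !![0, 3; 1, 4; 2, 0] p.1 p.2, ?_, ?_⟩ <;> decide
end

section
/- No acyclic orientation of the butterfly-type network with d1 = d4 = 2, d2 = d3 = 3 and middle channel of arbitrary alphabet size m can perfectly transmit all 6 source messages, regardless of how large m is. Precisely: (a) there do not exist functions g : Fin 3 → Fin m, f1 : Fin 2 × Fin m → Fin 3, f2 : Fin 3 → Fin 2 and decoder D : Fin 3 × Fin 2 → Fin 2 × Fin 3 such that for all x1 : Fin 2, x2 : Fin 3, D(f1(x1, g(x2)), f2(x2)) = (x1, x2) (middle channel directed n2 → n1); and (b) there do not exist functions g' : Fin 2 → Fin m, f1 : Fin 2 → Fin 3, f2 : Fin 3 × Fin m → Fin 2 and decoder D : Fin 3 × Fin 2 → Fin 2 × Fin 3 such that for all x1, x2, D(f1(x1), f2(x2,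 g'(x1))) = (x1, x2) (middle channel directed n1 → n2). -/
/-- no acyclic orientation of the butterfly-type network with
`d1 = d4 = 2`, `d2 = d3 = 3` and middle channel of arbitrary alphabet size `m`
can perfectly transmit all `6` source messages: (a) with the middle channel
directed `n2 → n1`, and (b) with the middle channel directed `n1 → n2`, there
is no choice of node functions and decoder recovering every pair
`(x1, x2) : Fin 2 × Fin 3`. -/
theorem stmt12 (m : ℕ) :
    (¬ ∃ (g : Fin 3 → Fin m) (f1 : Fin 2 × Fin m → Fin 3) (f2 : Fin 3 → Fin 2)
        (D : Fin 3 × Fin 2 → Fin 2 × Fin 3),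
        ∀ (x1 : Fin 2) (x2 : Fin 3), D (f1 (x1, g x2), f2 x2) = (x1, x2)) ∧
    (¬ ∃ (g' : Fin 2 → Fin m) (f1 : Fin 2 → Fin 3) (f2 : Fin 3 × Fin m → Fin 2)
        (D : Fin 3 × Fin 2 → Fin 2 × Fin 3),
        ∀ (x1 : Fin 2) (x2 : Fin 3), D (f1 x1, f2 (x2, g' x1)) = (x1, x2)) := by
  constructor
  · rintro ⟨g, f1, f2, D, h⟩
    obtain ⟨a, b, hab, hf⟩ :=
      Fintype.exists_ne_map_eq_of_card_lt f2 (by simp)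
    obtain ⟨⟨x, p⟩, ⟨y, q⟩, hne, heq⟩ :=
      Fintype.exists_ne_map_eq_of_card_lt
        (fun z : Fin 2 × Bool => f1 (z.1, g (bif z.2 then a else b))) (by simp)
    have hp : ∀ r : Bool, f2 (bif r then a else b) = f2 a := by
      rintro (_ | _)
      exacts [hf.symm, rfl]
    have key : (x, bif p then a else b) = (y, bif q then a else b) := by
      rw [← h x, ← h y, hp p, hp q]
      exact congrArg (fun c => D (c, f2 a)) heq
    obtain ⟨rfl, hpq⟩ := Prod.mk.inj key
    cases p <;> cases q <;> simp_all
  · rintro ⟨g', f1, f2, D, h⟩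
    obtain ⟨a, b, hab, hf⟩ :=
      Fintype.exists_ne_map_eq_of_card_lt (fun z : Fin 3 => f2 (z, g' 0)) (by simp)
    have key : ((0 : Fin 2), a) = (0, b) := by
      rw [← h 0 a, ← h 0 b]
      exact congrArg (fun c => D (f1 0, c)) hf
    exact hab (Prod.mk.inj key).2
end

section
/- Teleportation-based lower bound for uniformly scaled butterfly networks: for all integers d1, d2, d3, d4, d5 ≥ 1 and every k ≥ 1, the one-shot tensor-network capacity satisfies R1(B(k·d1, k·d2, k·d3, k·d4, k·d5)) ≥ k² · R1(B(d1, d2, d3, d4, k·d5)). -/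
/-- A block diagonal matrix with constant blocks `A` has rank at least the number of blocks
times the rank of `A`. -/
theorem card_mul_rank_le_rank_blockDiagonal {m n o K : Type*} [Fintype m] [Fintype n]
    [Fintype o] [DecidableEq o] [Field K] (A : Matrix m n K) :
    Fintype.card o * A.rank ≤ (Matrix.blockDiagonal fun _ : o => A).rank := by
  let φ : (o → A.mulVecLin.range) →ₗ[K] (m × o → K) :=
    { toFun := fun f p => (f p.2 : m → K) p.1
      map_add' := fun _ _ => rfl
      map_smul' := fun _ _ => rfl }
  have hφ (f) : φ f ∈ (Matrix.blockDiagonal fun _ : o => A).mulVecLin.range := by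
    choose v hv using fun k => (f k).2
    refine ⟨fun p => v p.2 p.1, funext fun ⟨i, k⟩ => ?_⟩
    have h := congrFun (hv k) i
    simp only [Matrix.mulVecLin_apply, Matrix.mulVec, dotProduct] at h ⊢
    simp [φ, ← h, Matrix.blockDiagonal_apply, Fintype.sum_prod_type, ite_mul]
  have hinj : Function.Injective (φ.codRestrict _ hφ) := fun f g h =>
    funext fun k => Subtype.ext <| funext fun i => congrFun (congrArg Subtype.val h) (i, k)
  have h := LinearMap.finrank_le_finrank_of_injective hinj
  rwa [Module.finrank_pi_fintype, Finset.sum_const, Finset.card_univ, smul_eq_mul] at h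

theorem rank_butterflyM_le_butterflyR1 {d1 d2 d3 d4 d5 : ℕ}
    (T1 : Fin d1 × Fin d3 × Fin d5 → ℂ) (T2 : Fin d2 × Fin d4 × Fin d5 → ℂ) :
    (butterflyM d1 d2 d3 d4 d5 T1 T2).rank ≤ butterflyR1 d1 d2 d3 d4 d5 :=
  le_csSup ⟨_, by rintro _ ⟨T1, T2, rfl⟩; exact Matrix.rank_le_card_width _⟩ ⟨T1, T2, rfl⟩

theorem exists_rank_butterflyM_eq_butterflyR1 (d1 d2 d3 d4 d5 : ℕ) :
    ∃ T1 T2, (butterflyM d1 d2 d3 d4 d5 T1 T2).rank = butterflyR1 d1 d2 d3 d4 d5 :=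
  Nat.sSup_mem (s := {n | ∃ T1 T2, (butterflyM d1 d2 d3 d4 d5 T1 T2).rank = n}) ⟨_, 0, 0, rfl⟩
    ⟨_, by rintro _ ⟨T1, T2, rfl⟩; exact Matrix.rank_le_card_width _⟩

/-- Splits each of the two dimensions `k * a`, `k * b` into a factor of size `k` and a rest, and
collects the factors of size `k`. -/
def finMulProdEquiv (k a b : ℕ) :
    Fin (k * a) × Fin (k * b) ≃ (Fin a × Fin b) × (Fin k × Fin k) :=
  ((finProdFinEquiv.symm.prodCongr finProdFinEquiv.symm).trans
    (Equiv.prodProdProdComm _ _ _ _)).trans (Equiv.prodComm _ _)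

/-- Tensoring `T` with the identity of size `k` between its first two legs. -/
def tensorOne (k : ℕ) {a b c : ℕ} (T : Fin a × Fin b × Fin c → ℂ) :
    Fin (k * a) × Fin (k * b) × Fin c → ℂ := fun p =>
  if (finProdFinEquiv.symm p.2.1).1 = (finProdFinEquiv.symm p.1).1 then
    T ((finProdFinEquiv.symm p.1).2, (finProdFinEquiv.symm p.2.1).2, p.2.2)
  else 0

theorem butterflyM_tensorOne (k : ℕ) {d1 d2 d3 d4 d5 : ℕ}
    (T1 : Fin d1 × Fin d3 × Fin d5 → ℂ) (T2 : Fin d2 × Fin d4 × Fin d5 → ℂ) :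
    butterflyM (k * d1) (k * d2) (k * d3) (k * d4) d5 (tensorOne k T1) (tensorOne k T2) =
      (Matrix.blockDiagonal fun _ : Fin k × Fin k => butterflyM d1 d2 d3 d4 d5 T1 T2).submatrix
        (finMulProdEquiv k d3 d4) (finMulProdEquiv k d1 d2) := by
  ext ⟨r1, r2⟩ ⟨c1, c2⟩
  obtain ⟨r1, rfl⟩ := finProdFinEquiv.surjective r1
  obtain ⟨r2, rfl⟩ := finProdFinEquiv.surjective r2
  obtain ⟨c1, rfl⟩ := finProdFinEquiv.surjective c1
  obtain ⟨c2, rfl⟩ := finProdFinEquiv.surjective c2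
  simp only [butterflyM, tensorOne, finMulProdEquiv, Matrix.submatrix_apply,
    Matrix.blockDiagonal_apply, Equiv.trans_apply, Equiv.prodCongr_apply, Prod.map_apply,
    Equiv.symm_apply_apply, Equiv.prodProdProdComm_apply, Equiv.prodComm_apply, Prod.swap_prod_mk,
    Prod.mk.injEq]
  by_cases h1 : r1.1 = c1.1 <;> by_cases h2 : r2.1 = c2.1 <;> simp [h1, h2]

/-- teleportation-based lower bound for uniformly scaled
butterfly networks:
`R1(B(k·d1, k·d2, k·d3, k·d4, k·d5)) ≥ k² · R1(B(d1, d2, d3, d4, k·d5))`. -/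
theorem stmt13 (d1 d2 d3 d4 d5 k : ℕ)
    (h1 : 1 ≤ d1) (h2 : 1 ≤ d2) (h3 : 1 ≤ d3) (h4 : 1 ≤ d4) (h5 : 1 ≤ d5)
    (hk : 1 ≤ k) :
    k ^ 2 * butterflyR1 d1 d2 d3 d4 (k * d5) ≤
      butterflyR1 (k * d1) (k * d2) (k * d3) (k * d4) (k * d5) := by
  obtain ⟨T1, T2, hT⟩ := exists_rank_butterflyM_eq_butterflyR1 d1 d2 d3 d4 (k * d5)
  calc k ^ 2 * butterflyR1 d1 d2 d3 d4 (k * d5)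
      = Fintype.card (Fin k × Fin k) * (butterflyM d1 d2 d3 d4 (k * d5) T1 T2).rank := by
        simp [hT, sq]
    _ ≤ _ := card_mul_rank_le_rank_blockDiagonal _
    _ = _ := by rw [butterflyM_tensorOne, Matrix.rank_submatrix]
    _ ≤ _ := rank_butterflyM_le_butterflyR1 (tensorOne k T1) (tensorOne k T2)
end

section
/- The scaled-dimension conjecture holds for butterfly-type networks: for all integers d1, d2, d3, d4 ≥ 2 and d5 ≥ 2, there exists K such that for every k ≥ K, the one-shot tensor-network capacity of the uniformly scaled network achieves the min-cut: R1(B(k·d1, k·d2, k·d3, k·d4, k·d5)) = MC(B(k·d1, k·d2, k·d3, k·d4, k·d5)) = k² · min(d1·d2, d3·d4). -/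
/-- Any matrix `M₀` of operator Schmidt rank at most `D`, inflated by identity matrices on both
tensor factors, is the contraction matrix of a scaled butterfly network with bottleneck `D`. -/
theorem exists_butterflyM_eq_inflation (k d1 d2 d3 d4 D : ℕ) (hD : d1 * d3 ≤ D)
    (M₀ : Matrix (Fin d3 × Fin d4) (Fin d1 × Fin d2) ℂ) :
    ∃ (T1 : Fin (k * d1) × Fin (k * d3) × Fin D → ℂ)
      (T2 : Fin (k * d2) × Fin (k * d4) × Fin D → ℂ),
      ∀ (u v u' v' : Fin k) (x : Fin d1) (y : Fin d3) (x' : Fin d2) (y' : Fin d4),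
        butterflyM (k * d1) (k * d2) (k * d3) (k * d4) D T1 T2
          (finProdFinEquiv (v, y), finProdFinEquiv (v', y'))
          (finProdFinEquiv (u, x), finProdFinEquiv (u', x')) =
        if u = v ∧ u' = v' then M₀ (y, y') (x, x') else 0 := by
  let ι : Fin d1 × Fin d3 → Fin D := fun p => Fin.castLE hD (finProdFinEquiv p)
  have hι : Function.Injective ι :=
    (Fin.castLE_injective hD).comp finProdFinEquiv.injective
  refine ⟨fun a =>
      let p := finProdFinEquiv.symm a.1
      let q := finProdFinEquiv.symm a.2.1
      if p.1 = q.1 then if a.2.2 = ι (p.2, q.2) then 1 else 0 else 0,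
    fun a =>
      let p := finProdFinEquiv.symm a.1
      let q := finProdFinEquiv.symm a.2.1
      if p.1 = q.1 then ∑ r, if ι r = a.2.2 then M₀ (r.2, q.2) (r.1, p.2) else 0 else 0, ?_⟩
  intro u v u' v' x y x' y'
  by_cases hu : u = v <;> by_cases hv : u' = v' <;>
    simp [butterflyM, hu, hv, hι.eq_iff, -finProdFinEquiv_symm_apply, -finProdFinEquiv_apply_val]

/-- If the bottleneck dimension is at least `d1 * d3`, a scaled butterfly network has a contraction
matrix of rank at least `k ^ 2 * min (d1 * d2) (d3 * d4)`. -/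
theorem exists_le_rank_butterflyM (k d1 d2 d3 d4 D : ℕ) (hD : d1 * d3 ≤ D) :
    ∃ (T1 : Fin (k * d1) × Fin (k * d3) × Fin D → ℂ)
      (T2 : Fin (k * d2) × Fin (k * d4) × Fin D → ℂ),
      k ^ 2 * min (d1 * d2) (d3 * d4) ≤
        (butterflyM (k * d1) (k * d2) (k * d3) (k * d4) D T1 T2).rank := by
  let m := min (d1 * d2) (d3 * d4)
  let f : Fin m → Fin d3 × Fin d4 := fun i =>
    finProdFinEquiv.symm (Fin.castLE (min_le_right _ _) i)
  let g : Fin m → Fin d1 × Fin d2 := fun i =>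
    finProdFinEquiv.symm (Fin.castLE (min_le_left _ _) i)
  have hf : Function.Injective f :=
    finProdFinEquiv.symm.injective.comp (Fin.castLE_injective _)
  have hg : Function.Injective g :=
    finProdFinEquiv.symm.injective.comp (Fin.castLE_injective _)
  obtain ⟨T1, T2, h⟩ := exists_butterflyM_eq_inflation k d1 d2 d3 d4 D hD
    (fun r c => ∑ i : Fin m, if f i = r ∧ g i = c then 1 else 0)
  refine ⟨T1, T2, ?_⟩
  have hone : (butterflyM (k * d1) (k * d2) (k * d3) (k * d4) D T1 T2).submatrix
      (fun t : (Fin k × Fin k) × Fin m =>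
        (finProdFinEquiv (t.1.1, (f t.2).1), finProdFinEquiv (t.1.2, (f t.2).2)))
      (fun t : (Fin k × Fin k) × Fin m =>
        (finProdFinEquiv (t.1.1, (g t.2).1), finProdFinEquiv (t.1.2, (g t.2).2))) = 1 := by
    ext ⟨⟨v, v'⟩, i⟩ ⟨⟨u, u'⟩, j⟩
    rw [Matrix.submatrix_apply, h]
    simp only [Prod.mk.eta, hf.eq_iff, hg.eq_iff, Matrix.one_apply, Prod.mk.injEq, ite_and,
      Finset.sum_ite_eq', Finset.mem_univ, if_true]
    grind
  calc k ^ 2 * m = (1 : Matrix ((Fin k × Fin k) × Fin m) ((Fin k × Fin k) × Fin m) ℂ).rank := by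
        simp [Matrix.rank_one, sq]
    _ ≤ _ := hone ▸ Matrix.rank_submatrix_le _ _ _

/-- Every contraction matrix has rank at most `min (d1 * d2) (d3 * d4)`. -/
theorem rank_butterflyM_le (d1 d2 d3 d4 d5 : ℕ)
    (T1 : Fin d1 × Fin d3 × Fin d5 → ℂ) (T2 : Fin d2 × Fin d4 × Fin d5 → ℂ) :
    (butterflyM d1 d2 d3 d4 d5 T1 T2).rank ≤ min (d1 * d2) (d3 * d4) :=
  le_min (by simpa using (butterflyM d1 d2 d3 d4 d5 T1 T2).rank_le_card_width)
    (by simpa using (butterflyM d1 d2 d3 d4 d5 T1 T2).rank_le_card_height)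

/-- the scaled-dimension conjecture holds for butterfly-type
networks: for sufficiently large `k`, the uniformly scaled network achieves
the min-cut, `R1(B(k·d1,…,k·d5)) = MC(B(k·d1,…,k·d5)) = k² · min(d1·d2, d3·d4)`. -/
theorem stmt14 (d1 d2 d3 d4 d5 : ℕ)
    (h1 : 2 ≤ d1) (h2 : 2 ≤ d2) (h3 : 2 ≤ d3) (h4 : 2 ≤ d4) (h5 : 2 ≤ d5) :
    ∃ K : ℕ, ∀ k ≥ K,
      butterflyR1 (k * d1) (k * d2) (k * d3) (k * d4) (k * d5) =
        butterflyMC (k * d1) (k * d2) (k * d3) (k * d4) (k * d5) ∧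
      butterflyMC (k * d1) (k * d2) (k * d3) (k * d4) (k * d5) =
        k ^ 2 * min (d1 * d2) (d3 * d4) := by
  have hscale : ∀ k, min (k * d1 * (k * d2)) (k * d3 * (k * d4)) =
      k ^ 2 * min (d1 * d2) (d3 * d4) := fun k => by
    rw [← Nat.mul_min_mul_left]
    congr 1 <;> ring
  refine ⟨d1 * d3 + d1 + d2, fun k hk => ?_⟩
  have hMC : butterflyMC (k * d1) (k * d2) (k * d3) (k * d4) (k * d5) =
      k ^ 2 * min (d1 * d2) (d3 * d4) := by
    rw [butterflyMC, hscale, min_eq_left]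
    have hd1 : d1 ≤ k * d3 * d5 := by
      rw [mul_assoc]
      exact (show d1 ≤ k by lia).trans (Nat.le_mul_of_pos_right k (by positivity))
    have hd2 : d2 ≤ k * d4 * d5 := by
      rw [mul_assoc]
      exact (show d2 ≤ k by lia).trans (Nat.le_mul_of_pos_right k (by positivity))
    refine le_min ?_ ?_
    · calc k ^ 2 * min (d1 * d2) (d3 * d4) ≤ k ^ 2 * (d1 * d2) := by gcongr; exact min_le_left _ _
        _ ≤ k ^ 2 * (k * d3 * d5 * d2) := by gcongr
        _ = _ := by ring
    · calc k ^ 2 * min (d1 * d2) (d3 * d4) ≤ k ^ 2 * (d1 * d2) := by gcongr; exact min_le_left _ _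
        _ ≤ k ^ 2 * (d1 * (k * d4 * d5)) := by gcongr
        _ = _ := by ring
  refine ⟨?_, hMC⟩
  obtain ⟨T1, T2, hT⟩ := exists_le_rank_butterflyM k d1 d2 d3 d4 (k * d5)
    ((show d1 * d3 ≤ k by lia).trans (Nat.le_mul_of_pos_right k (by lia)))
  have hle := fun T1 T2 =>
    (rank_butterflyM_le (k * d1) (k * d2) (k * d3) (k * d4) (k * d5) T1 T2).trans_eq (hscale k)
  rw [hMC]
  refine IsGreatest.csSup_eq ⟨⟨T1, T2, (hle T1 T2).antisymm hT⟩, ?_⟩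
  rintro _ ⟨S1, S2, rfl⟩
  exact hle S1 S2
end
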